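/- Let J be a finite nonempty set, let κ_j > 0 for j ∈ J, let κ̄ = (1/|J|)·∑_{j ∈ J} κ_j, and suppose K ≥ 1 satisfies max_{j ∈ J} κ_j ≤ K·κ̄. Then ∑_{j ∈ J} |κ_j − κ̄| ≤ |J|·κ̄·√(K − 1). -/

import Mathlib

/-- If `κ j > 0` for `j` in a finite nonempty set `J`,
`κ̄ = (1/|J|)·∑ κ j`, and `K ≥ 1` satisfies `max κ j ≤ K·κ̄`, then
`∑ⱼ |κ j − κ̄| ≤ |J|·κ̄·√(K − 1)`. -/
theorem sum_abs_dev_le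
    {J : Type*} [Fintype J] [Nonempty J]
    (κ : J → ℝ) (hκ : ∀ j, 0 < κ j)
    (K : ℝ) (hK : 1 ≤ K)
    (hmax : ∀ j, κ j ≤ K * ((∑ j, κ j) / (Fintype.card J : ℝ))) :
    ∑ j, |κ j - (∑ j, κ j) / (Fintype.card J : ℝ)| ≤
      (Fintype.card J : ℝ) * ((∑ j, κ j) / (Fintype.card J : ℝ)) *
        Real.sqrt (K - 1) := by
  have hn : (0:ℝ) < (Fintype.card J : ℝ) := by exact_mod_cast Fintype.card_pos
  have hS : ∑ j, κ j = (Fintype.card J : ℝ) * ((∑ j, κ j) / (Fintype.card J : ℝ)) := by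
    field_simp
  have hm : 0 ≤ (∑ j, κ j) / (Fintype.card J : ℝ) :=
    div_nonneg (Finset.sum_nonneg fun j _ => (hκ j).le) hn.le
  generalize (∑ j, κ j) / (Fintype.card J : ℝ) = m at *
  generalize hN : (Fintype.card J : ℝ) = n at *
  have h1 : (∑ j, |κ j - m|) ^ 2 ≤ n * ∑ j, |κ j - m| ^ 2 := by
    have h := sq_sum_le_card_mul_sum_sq (s := Finset.univ) (f := fun j => |κ j - m|)
    rwa [Finset.card_univ, hN] at h
  have h2 : ∑ j, |κ j - m| ^ 2 ≤ ∑ j, ((K * m - 2 * m) * κ j + m ^ 2) := by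
    apply Finset.sum_le_sum
    intro j _
    rw [sq_abs]
    nlinarith [mul_le_mul_of_nonneg_right (hmax j) (hκ j).le]
  rw [Finset.sum_add_distrib, ← Finset.mul_sum, hS, Finset.sum_const, Finset.card_univ,
    nsmul_eq_mul, hN] at h2
  have h3 : Real.sqrt (K - 1) ^ 2 = K - 1 := Real.sq_sqrt (by linarith)
  refine (abs_le_of_sq_le_sq' ?_ (by positivity)).2
  rw [mul_pow, h3]
  nlinarith [mul_le_mul_of_nonneg_left h2 hn.le]
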